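/- If A, B are local Noetherian rings with a local flat homomorphism A → B, then B is Gorenstein if and only if both A and B/𝔪_A·B are Gorenstein, where 𝔪_A is the maximal ideal of A. -/

import Mathlib

open CategoryTheory

/-- A commutative ring is a Gorenstein local ring if it is Noetherian, local,
and has finite injective dimension over itself; finiteness of the injective
dimension of `R` is expressed by the vanishing of `Ext^i(M, R)` for all
modules `M` and all `i` larger than some bound `d`. -/
def IsGorensteinLocalRing (R : Type) [CommRing R] : Prop :=
  IsNoetherianRing R ∧ IsLocalRing R ∧
    ∃ d : ℕ, ∀ (M : ModuleCat R) (i : ℕ), d < i →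
      Subsingleton (((Ext R (ModuleCat R) i).obj (Opposite.op M)).obj
        (ModuleCat.of R R))

section

open Abelian (Ext)
universe u

section
variable {C : Type*} [Category C] [Abelian C] [EnoughProjectives C]
  {k : Type*} [Ring k] [Linear k C]

lemma subsingleton_derived_ext_iff [HasExt C] (X Y : C) (n : ℕ) :
    Subsingleton (((_root_.Ext k C (n + 1)).obj (Opposite.op X)).obj Y) ↔
      Subsingleton (Ext X Y (n + 1)) := by
  let P := projectiveResolution X
  have h₁ : Subsingleton (((_root_.Ext k C (n + 1)).obj (Opposite.op X)).obj Y) ↔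
      ∀ f : P.complex.X (n + 1) ⟶ Y, P.complex.d (n + 2) (n + 1) ≫ f = 0 →
        ∃ g : P.complex.X n ⟶ Y, P.complex.d (n + 1) n ≫ g = f := by
    rw [← ModuleCat.isZero_iff_subsingleton, (P.isoExt (R := k) (n + 1) Y).isZero_iff,
      ← HomologicalComplex.exactAt_iff_isZero_homology,
      HomologicalComplex.exactAt_iff' _ n (n + 1) (n + 2) (by simp) (by simp),
      ShortComplex.moduleCat_exact_iff]
    rfl
  have h₂ : Subsingleton (Ext X Y (n + 1)) ↔
      ∀ f : P.complex.X (n + 1) ⟶ Y, P.complex.d (n + 2) (n + 1) ≫ f = 0 →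
        ∃ g : P.complex.X n ⟶ Y, P.complex.d (n + 1) n ≫ g = f := by
    constructor
    · intro h f hf
      exact (P.extMk_eq_zero_iff f (n + 2) rfl hf n rfl).1 (Subsingleton.elim _ _)
    · intro h
      refine subsingleton_of_forall_eq 0 fun α ↦ ?_
      obtain ⟨f, hf, rfl⟩ := P.extMk_surjective α (n + 2) rfl
      exact (P.extMk_eq_zero_iff f (n + 2) rfl hf n rfl).2 (h f hf)
  rw [h₁, h₂]
end

section
variable {C : Type*} [Category C] [Abelian C] [HasExt C] {S : ShortComplex C}

lemma subsingleton_ext_X₃_iff_surjective (hS : S.ShortExact) {Y : C} {n : ℕ}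
    (h : Subsingleton (Ext S.X₂ Y (n + 1))) :
    Subsingleton (Ext S.X₃ Y (n + 1)) ↔
      ∀ x : Ext S.X₁ Y n, ∃ y : Ext S.X₂ Y n, (Ext.mk₀ S.f).comp y (zero_add n) = x := by
  constructor
  · intro h₃ x
    exact Ext.contravariant_sequence_exact₁ hS Y x (add_comm 1 n) (Subsingleton.elim _ _)
  · intro hsurj
    refine subsingleton_of_forall_eq 0 fun z ↦ ?_
    obtain ⟨x, rfl⟩ := Ext.contravariant_sequence_exact₃ hS Y z (Subsingleton.elim _ _)
      (add_comm 1 n)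
    obtain ⟨y, rfl⟩ := hsurj x
    rw [← Ext.comp_assoc _ _ _ (add_zero 1) (zero_add n) (by lia),
      hS.extClass_comp, Ext.zero_comp]

lemma subsingleton_ext_X₃_iff_X₁ (hS : S.ShortExact) {Y : C} {n : ℕ}
    (h : Subsingleton (Ext S.X₂ Y n)) (h' : Subsingleton (Ext S.X₂ Y (n + 1))) :
    Subsingleton (Ext S.X₃ Y (n + 1)) ↔ Subsingleton (Ext S.X₁ Y n) := by
  rw [subsingleton_ext_X₃_iff_surjective hS h']
  constructor
  · intro hsurj
    refine subsingleton_of_forall_eq 0 fun x ↦ ?_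
    obtain ⟨y, rfl⟩ := hsurj x
    rw [Subsingleton.elim y 0, Ext.comp_zero]
  · exact fun _ _ ↦ ⟨0, Subsingleton.elim _ _⟩

lemma subsingleton_ext_X₂ (hS : S.ShortExact) {Y : C} {n : ℕ}
    (h₁ : Subsingleton (Ext S.X₁ Y n)) (h₃ : Subsingleton (Ext S.X₃ Y n)) :
    Subsingleton (Ext S.X₂ Y n) := by
  refine subsingleton_of_forall_eq 0 fun x ↦ ?_
  obtain ⟨z, rfl⟩ := Ext.contravariant_sequence_exact₂ hS Y x (Subsingleton.elim _ _)
  rw [Subsingleton.elim z 0, Ext.comp_zero]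

lemma subsingleton_ext_of_iso_left {X X' Y : C} (e : X ≅ X') {n : ℕ}
    (_ : Subsingleton (Ext X Y n)) : Subsingleton (Ext X' Y n) := by
  refine subsingleton_of_forall_eq 0 fun x ↦ ?_
  rw [← x.mk₀_id_comp, ← e.inv_hom_id, ← Ext.mk₀_comp_mk₀,
    Ext.comp_assoc_of_second_deg_zero, Subsingleton.elim ((Ext.mk₀ e.hom).comp x _) 0,
    Ext.comp_zero]

lemma subsingleton_ext_of_iso_right {X Y Y' : C} (e : Y ≅ Y') {n : ℕ}
    (_ : Subsingleton (Ext X Y n)) : Subsingleton (Ext X Y' n) := by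
  refine subsingleton_of_forall_eq 0 fun x ↦ ?_
  rw [← x.comp_mk₀_id, ← e.inv_hom_id, ← Ext.mk₀_comp_mk₀,
    ← Ext.comp_assoc_of_third_deg_zero, Subsingleton.elim (x.comp (Ext.mk₀ e.inv) _) 0,
    Ext.zero_comp]
end

lemma exists_subsingleton_derived_ext_iff (R : Type) [CommRing R] :
    (∃ d : ℕ, ∀ (M : ModuleCat R) (i : ℕ), d < i →
      Subsingleton (((_root_.Ext R (ModuleCat R) i).obj (Opposite.op M)).obj
        (ModuleCat.of R R))) ↔ ∃ n, HasInjectiveDimensionLT (ModuleCat.of R R) n := by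
  constructor
  · rintro ⟨d, hd⟩
    exact ⟨d + 1, hasInjectiveDimensionLT_of_enoughProjectives _ _ fun Y ↦
      (subsingleton_derived_ext_iff Y _ d).1 (hd Y _ (by lia))⟩
  · rintro ⟨d, hd⟩
    refine ⟨d, fun M i hi ↦ ?_⟩
    obtain ⟨i, rfl⟩ := Nat.exists_eq_succ_of_ne_zero (by lia : i ≠ 0)
    exact (subsingleton_derived_ext_iff M _ i).2
      (HasInjectiveDimensionLT.subsingleton _ d _ (by lia) _)

section
variable {R : Type u} [CommRing R]

lemma hasInjectiveDimensionLT_of_subsingleton_ext_quotient (M : ModuleCat.{u} R) (n : ℕ)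
    (h : ∀ I : Ideal R, Subsingleton (Ext (ModuleCat.of R (R ⧸ I)) M n)) :
    HasInjectiveDimensionLT M n := by
  induction n generalizing M with
  | zero =>
    rw [hasInjectiveDimensionLT_zero_iff_isZero, ModuleCat.isZero_iff_subsingleton]
    have := Ext.homEquiv₀.subsingleton_congr.mp (h ⊥)
    refine subsingleton_of_forall_eq 0 fun m ↦ ?_
    have h0 : LinearMap.toSpanSingleton R M m ∘ₗ
        (Submodule.quotEquivOfEqBot (⊥ : Ideal R) rfl).toLinearMap = 0 :=
      congrArg ModuleCat.Hom.hom (Subsingleton.elim (ModuleCat.ofHom (X := R ⧸ (⊥ : Ideal R)) _)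
        (ModuleCat.ofHom 0))
    have h1 := LinearMap.congr_fun h0 (Submodule.Quotient.mk 1)
    rwa [LinearMap.comp_apply, LinearEquiv.coe_coe, Submodule.quotEquivOfEqBot_apply_mk,
      LinearMap.toSpanSingleton_apply, one_smul] at h1
  | succ n ih =>
    obtain _ | n := n
    · rw [← injective_iff_hasInjectiveDimensionLT_one, ← Module.injective_iff_injective_object]
      refine Module.Baer.iff_injective.mp fun I g ↦ ?_
      have hS := LinearMap.shortExact_shortComplexKer (f := I.mkQ) I.mkQ_surjective
      have e : LinearMap.ker I.mkQ = I := I.ker_mkQ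
      obtain ⟨y, hy⟩ := (subsingleton_ext_X₃_iff_surjective hS
        (Ext.subsingleton_of_projective (ModuleCat.of R R) M 0)).1 (h I)
        (Ext.mk₀ (ModuleCat.ofHom (g ∘ₗ (LinearEquiv.ofEq _ _ e).toLinearMap)))
      obtain ⟨y, rfl⟩ := Ext.homEquiv₀.symm.surjective y
      simp only [Ext.homEquiv₀_symm_apply, Ext.mk₀_comp_mk₀] at hy
      have hy := (Ext.mk₀_bijective _ _).1 hy
      refine ⟨y.hom, fun x hx ↦ ?_⟩
      exact LinearMap.congr_fun (congrArg ModuleCat.Hom.hom hy) ⟨x, e.ge hx⟩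
    · let P := (EnoughInjectives.presentation M).some
      have hS : (ShortComplex.mk P.f (Limits.cokernel.π P.f) (by simp)).ShortExact :=
        { exact := ShortComplex.exact_cokernel P.f }
      rw [← hS.hasInjectiveDimensionLT_X₃_iff n inferInstance]
      refine ih _ fun I ↦ subsingleton_of_forall_eq 0 fun x ↦ ?_
      obtain ⟨y, rfl⟩ := Ext.covariant_sequence_exact₃ _ hS x rfl
        ((h I).elim _ _)
      rw [Ext.eq_zero_of_injective y, Ext.zero_comp]

lemma shortExact_of_linearMap {M N P : Type u} [AddCommGroup M] [AddCommGroup N] [AddCommGroup P]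
    [Module R M] [Module R N] [Module R P] {f : M →ₗ[R] N} {g : N →ₗ[R] P}
    (hf : Function.Injective f) (h : Function.Exact f g) (hg : Function.Surjective g) :
    (ModuleCat.shortComplexOfCompEqZero f g h.linearMap_comp_eq_zero).ShortExact :=
  ModuleCat.shortComplex_shortExact _ h hf hg

/-- Multiplication by `a` induces a short exact sequence `R/(I : a) → R/I → R/(I + (a))`. -/
lemma shortExact_colon (I J : Ideal R) (a : R)
    (hJ : J = Submodule.comap (LinearMap.lsmul R R a) I) :
    ∃ h, (ModuleCat.shortComplexOfCompEqZero
      (Submodule.mapQ J I (LinearMap.lsmul R R a) hJ.le)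
      (Submodule.factor (le_sup_left : I ≤ I ⊔ Ideal.span {a})) h).ShortExact := by
  refine ⟨_, shortExact_of_linearMap ?_ (fun y ↦ ?_) (Submodule.factor_surjective _)⟩
  · rw [injective_iff_map_eq_zero]
    intro x hx
    obtain ⟨x, rfl⟩ := Submodule.Quotient.mk_surjective _ x
    rw [Submodule.mapQ_apply, Submodule.Quotient.mk_eq_zero] at hx
    rw [Submodule.Quotient.mk_eq_zero, hJ]
    exact hx
  · obtain ⟨y, rfl⟩ := Submodule.Quotient.mk_surjective _ y
    rw [← Submodule.mkQ_apply, Submodule.factor_mk, Submodule.mkQ_apply, Submodule.mkQ_apply,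
      Submodule.Quotient.mk_eq_zero]
    constructor
    · intro hy
      obtain ⟨z, hz, w, hw, rfl⟩ := Submodule.mem_sup.1 hy
      obtain ⟨r, rfl⟩ := Ideal.mem_span_singleton'.1 hw
      refine ⟨Submodule.Quotient.mk r, ?_⟩
      rw [Submodule.mapQ_apply, Submodule.Quotient.eq]
      simpa [mul_comm a r] using hz
    · rintro ⟨x, hx⟩
      obtain ⟨x, rfl⟩ := Submodule.Quotient.mk_surjective _ x
      rw [Submodule.mapQ_apply, eq_comm, Submodule.Quotient.eq] at hx
      rw [← sub_add_cancel y ((LinearMap.lsmul R R a) x)]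
      exact add_mem (Ideal.mem_sup_left hx)
        (Ideal.mem_sup_right (Ideal.mul_mem_right _ _ (Ideal.mem_span_singleton_self a)))

lemma subsingleton_ext_quotient_of_residue [IsNoetherianRing R] [IsLocalRing R]
    (M : ModuleCat.{u} R) [Module.Finite R M] (n : ℕ)
    (h : ∀ i, n ≤ i →
      Subsingleton (Ext (ModuleCat.of R (R ⧸ IsLocalRing.maximalIdeal R)) M i)) (I : Ideal R) :
    ∀ i, n ≤ i → Subsingleton (Ext (ModuleCat.of R (R ⧸ I)) M i) := by
  induction I using IsNoetherian.induction with
  | hgt I ih =>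
  intro i hi
  by_cases hm : I = IsLocalRing.maximalIdeal R
  · exact hm ▸ h i hi
  by_cases htop : I = ⊤
  · have : Subsingleton (R ⧸ I) := by rw [htop]; infer_instance
    have hz : Limits.IsZero (ModuleCat.of R (R ⧸ I)) := ModuleCat.isZero_of_subsingleton _
    refine subsingleton_of_forall_eq 0 fun x ↦ ?_
    rw [← x.mk₀_id_comp, hz.eq_of_src (𝟙 _) 0, Ext.mk₀_zero, Ext.zero_comp]
  have hlt : I < IsLocalRing.maximalIdeal R :=
    lt_of_le_of_ne (IsLocalRing.le_maximalIdeal htop) hm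
  by_cases hcol : ∃ a b, a ∉ I ∧ b ∉ I ∧ a * b ∈ I
  · obtain ⟨a, b, ha, hb, hab⟩ := hcol
    let J : Ideal R := Submodule.comap (LinearMap.lsmul R R a) I
    obtain ⟨_, hS⟩ := shortExact_colon I J a rfl
    refine subsingleton_ext_X₂ hS (ih J ?_ i hi) (ih _ ?_ i hi)
    · exact SetLike.lt_iff_le_and_exists.2 ⟨fun r hr ↦ Ideal.mul_mem_left I a hr, b, hab, hb⟩
    · exact SetLike.lt_iff_le_and_exists.2 ⟨le_sup_left, a,
        Ideal.mem_sup_right (Ideal.mem_span_singleton_self a), ha⟩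
  · push Not at hcol
    obtain ⟨a, ham, ha⟩ := SetLike.exists_of_lt hlt
    have hI : I = Submodule.comap (LinearMap.lsmul R R a) I := le_antisymm
      (fun r hr ↦ Ideal.mul_mem_left I a hr) fun r hr ↦ by_contra fun hr' ↦ hcol a r ha hr' hr
    obtain ⟨_, hS⟩ := shortExact_colon I I a hI
    have h₃ := ih (I ⊔ Ideal.span {a}) (SetLike.lt_iff_le_and_exists.2 ⟨le_sup_left, a,
        Ideal.mem_sup_right (Ideal.mem_span_singleton_self a), ha⟩) (i + 1) (by lia)
    have key : (⊤ : Submodule R (Ext (ModuleCat.of R (R ⧸ I)) M i)) = ⊥ := by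
      refine Submodule.eq_bot_of_le_smul_of_le_jacobson_bot (IsLocalRing.maximalIdeal R) _
        Module.Finite.fg_top (fun x _ ↦ ?_) (IsLocalRing.maximalIdeal_le_jacobson _)
      obtain ⟨y, rfl⟩ := Ext.contravariant_sequence_exact₁ hS M x (add_comm 1 i)
        (h₃.elim _ _)
      have hf : (ModuleCat.ofHom (Submodule.mapQ I I (LinearMap.lsmul R R a) hI.le)) =
          a • 𝟙 (ModuleCat.of R (R ⧸ I)) := by
        ext
        simp
        rfl
      change (Ext.mk₀ (ModuleCat.ofHom (Submodule.mapQ I I (LinearMap.lsmul R R a) _))).comp y _ ∈ _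
      rw [hf, Ext.mk₀_smul, Ext.smul_comp, Ext.mk₀_id_comp]
      exact Submodule.smul_mem_smul ham trivial
    exact (Submodule.subsingleton_iff R).1 (subsingleton_of_bot_eq_top key.symm)

lemma hasInjectiveDimensionLT_of_residue [IsNoetherianRing R] [IsLocalRing R]
    (M : ModuleCat.{u} R) [Module.Finite R M] (n : ℕ)
    (h : ∀ i, n ≤ i →
      Subsingleton (Ext (ModuleCat.of R (R ⧸ IsLocalRing.maximalIdeal R)) M i)) :
    HasInjectiveDimensionLT M n :=
  hasInjectiveDimensionLT_of_subsingleton_ext_quotient M n fun I ↦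
    subsingleton_ext_quotient_of_residue M n h I n le_rfl
end

section
open TensorProduct Module

variable {A : Type u} (B : Type u) [CommRing A] [CommRing B] [Algebra A B]

lemma surjective_lcomp_baseChange_iff [FaithfullyFlat A B] {K P : Type u}
    (M : Type u) [AddCommGroup K] [AddCommGroup P] [AddCommGroup M] [Module A K] [Module A P]
    [Module A M] [FinitePresentation A K] [FinitePresentation A P] (f : K →ₗ[A] P) :
    Function.Surjective ((f.baseChange B).lcomp B (B ⊗[A] M)) ↔
      Function.Surjective (f.lcomp A M) := by
  have hP := FinitePresentation.isBaseChange_map A P M B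
  have hK := FinitePresentation.isBaseChange_map A K M B
  have h : ((f.baseChange B).lcomp B (B ⊗[A] M)) ∘ₗ hP.equiv.toLinearMap =
      hK.equiv.toLinearMap ∘ₗ (f.lcomp A M).baseChange B := by
    refine TensorProduct.AlgebraTensorModule.curry_injective (LinearMap.ext fun s ↦
      LinearMap.ext fun φ ↦ ?_)
    simp only [TensorProduct.AlgebraTensorModule.curry_apply, TensorProduct.curry_apply,
      LinearMap.comp_apply, LinearEquiv.coe_coe, LinearMap.baseChange_tmul, IsBaseChange.equiv_tmul,
      LinearMap.baseChangeHom_apply, map_smul, LinearMap.coe_restrictScalars]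
    exact congrArg (s • ·) (LinearMap.baseChange_comp _ _).symm
  rw [← FaithfullyFlat.lTensor_surjective_iff_surjective A B]
  change _ ↔ Function.Surjective ((f.lcomp A M).baseChange B)
  have h' : ⇑((f.baseChange B).lcomp B (B ⊗[A] M)) ∘ ⇑hP.equiv =
      ⇑hK.equiv ∘ ⇑((f.lcomp A M).baseChange B) := congrArg DFunLike.coe h
  rw [← hK.equiv.toEquiv.comp_surjective, ← hP.equiv.toEquiv.surjective_comp]
  exact iff_of_eq (congrArg Function.Surjective h')

lemma surjective_mk₀_comp_iff {K P M : ModuleCat.{u} A} (f : K ⟶ P) :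
    (∀ x : Ext K M 0, ∃ y : Ext P M 0, (Ext.mk₀ f).comp y (zero_add 0) = x) ↔
      Function.Surjective (f.hom.lcomp A M) := by
  constructor
  · intro h x
    obtain ⟨y, hy⟩ := h (Ext.mk₀ (ModuleCat.ofHom x))
    obtain ⟨y, rfl⟩ := (Ext.mk₀_bijective _ _).2 y
    rw [Ext.mk₀_comp_mk₀] at hy
    exact ⟨y.hom, congrArg ModuleCat.Hom.hom ((Ext.mk₀_bijective _ _).1 hy)⟩
  · intro h x
    obtain ⟨x, rfl⟩ := (Ext.mk₀_bijective _ _).2 x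
    obtain ⟨y, hy⟩ := h x.hom
    refine ⟨Ext.mk₀ (ModuleCat.ofHom y), ?_⟩
    rw [Ext.mk₀_comp_mk₀]
    exact congrArg Ext.mk₀ (ModuleCat.hom_ext hy)

lemma subsingleton_ext_baseChange_iff [IsNoetherianRing A] [FaithfullyFlat A B]
    (N M : Type u) [AddCommGroup N] [AddCommGroup M] [Module A N] [Module A M]
    [Module.Finite A N] (n : ℕ) :
    Subsingleton (Ext (ModuleCat.of B (B ⊗[A] N)) (ModuleCat.of B (B ⊗[A] M)) (n + 1)) ↔
      Subsingleton (Ext (ModuleCat.of A N) (ModuleCat.of A M) (n + 1)) := by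
  induction n generalizing N with
  | zero =>
    obtain ⟨P, _, _, _, _, f, hf⟩ := Module.exists_finite_presentation A N
    have hS := LinearMap.shortExact_shortComplexKer hf
    have hS' := shortExact_of_linearMap (f := (LinearMap.ker f).subtype.baseChange B)
      (g := f.baseChange B) (Flat.lTensor_preserves_injective_linearMap _ Subtype.val_injective)
      (lTensor_exact B f.exact_subtype_ker_map hf) (LinearMap.lTensor_surjective B hf)
    have h₁ := subsingleton_ext_X₃_iff_surjective hS
      (Ext.subsingleton_of_projective (ModuleCat.of A P) (ModuleCat.of A M) 0)
    have h₂ := subsingleton_ext_X₃_iff_surjective hS' (Ext.subsingleton_of_projective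
      (ModuleCat.of B (B ⊗[A] P)) (ModuleCat.of B (B ⊗[A] M)) 0)
    refine h₂.trans (Iff.trans ?_ h₁.symm)
    rw [surjective_mk₀_comp_iff, surjective_mk₀_comp_iff]
    have := finitePresentation_of_finite A P
    have := finitePresentation_of_finite A (LinearMap.ker f)
    exact surjective_lcomp_baseChange_iff B M (LinearMap.ker f).subtype
  | succ n ih =>
    obtain ⟨P, _, _, _, _, f, hf⟩ := Module.exists_finite_presentation A N
    have hS := LinearMap.shortExact_shortComplexKer hf
    have hS' := shortExact_of_linearMap (f := (LinearMap.ker f).subtype.baseChange B)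
      (g := f.baseChange B) (Flat.lTensor_preserves_injective_linearMap _ Subtype.val_injective)
      (lTensor_exact B f.exact_subtype_ker_map hf) (LinearMap.lTensor_surjective B hf)
    have h₁ := subsingleton_ext_X₃_iff_X₁ hS
      (Ext.subsingleton_of_projective (ModuleCat.of A P) (ModuleCat.of A M) n)
      (Ext.subsingleton_of_projective (ModuleCat.of A P) (ModuleCat.of A M) (n + 1))
    have h₂ := subsingleton_ext_X₃_iff_X₁ hS'
      (Ext.subsingleton_of_projective (ModuleCat.of B (B ⊗[A] P)) (ModuleCat.of B (B ⊗[A] M)) n)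
      (Ext.subsingleton_of_projective (ModuleCat.of B (B ⊗[A] P)) (ModuleCat.of B (B ⊗[A] M))
        (n + 1))
    exact h₂.trans ((ih _).trans h₁.symm)

lemma subsingleton_ext_baseChange_self_iff [IsNoetherianRing A] [FaithfullyFlat A B]
    (N : Type u) [AddCommGroup N] [Module A N] [Module.Finite A N] (n : ℕ) :
    Subsingleton (Ext (ModuleCat.of B (B ⊗[A] N)) (ModuleCat.of B B) (n + 1)) ↔
      Subsingleton (Ext (ModuleCat.of A N) (ModuleCat.of A A) (n + 1)) := by
  rw [← subsingleton_ext_baseChange_iff B N A n]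
  let e : ModuleCat.of B (B ⊗[A] A) ≅ ModuleCat.of B B :=
    (TensorProduct.AlgebraTensorModule.rid A B B).toModuleIso
  exact ⟨subsingleton_ext_of_iso_right e.symm, subsingleton_ext_of_iso_right e⟩

lemma hasInjectiveDimensionLT_of_faithfullyFlat [IsNoetherianRing A] [FaithfullyFlat A B] (n : ℕ)
    [HasInjectiveDimensionLT (ModuleCat.of B B) (n + 1)] :
    HasInjectiveDimensionLT (ModuleCat.of A A) (n + 1) :=
  hasInjectiveDimensionLT_of_subsingleton_ext_quotient _ _ fun I ↦
    (subsingleton_ext_baseChange_self_iff B (A ⧸ I) n).1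
      (HasInjectiveDimensionLT.subsingleton _ (n + 1) _ le_rfl _)
end

section
open Module

variable {R S : Type u} [CommRing R] [CommRing S] [Algebra R S]

/-- A class `α` in `Ext^c_R(S, R)` that identifies `Hom_S(-, S)` with `Ext^c_R(-, R)` on
`S`-modules, while the higher groups `Ext^i_R(S, R)`, `i > c`, vanish. -/
structure IsShiftedDualClass {c : ℕ} (α : Ext (ModuleCat.of R S) (ModuleCat.of R R) c) : Prop where
  bijective : ∀ (L : Type u) [AddCommGroup L] [Module R L] [Module S L] [IsScalarTower R S L],
    Function.Bijective fun f : L →ₗ[S] S ↦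
      (Ext.mk₀ (ModuleCat.ofHom (f.restrictScalars R))).comp α (zero_add c)
  subsingleton : ∀ i, Subsingleton (Ext (ModuleCat.of R S) (ModuleCat.of R R) (c + i + 1))

lemma subsingleton_ext_pi {ι : Type} [Finite ι] (X : ModuleCat.{u} R) (n : ℕ)
    [Subsingleton (Ext (ModuleCat.of R S) X n)] :
    Subsingleton (Ext (ModuleCat.of R (ι → S)) X n) := by
  classical
  have := Fintype.ofFinite ι
  refine subsingleton_of_forall_eq 0 fun x ↦ ?_
  have h : 𝟙 (ModuleCat.of R (ι → S)) = ∑ j, ModuleCat.ofHom (LinearMap.proj j) ≫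
      ModuleCat.ofHom (LinearMap.single R (fun _ ↦ S) j) := by
    refine ModuleCat.hom_ext (LinearMap.ext fun v ↦ ?_)
    rw [ModuleCat.hom_sum, LinearMap.sum_apply]
    exact (Finset.univ_sum_single v).symm
  rw [← x.mk₀_id_comp, h, Ext.mk₀_sum, Ext.sum_comp]
  refine Finset.sum_eq_zero fun j _ ↦ ?_
  rw [← Ext.mk₀_comp_mk₀, Ext.comp_assoc_of_second_deg_zero, Subsingleton.elim
    ((Ext.mk₀ (ModuleCat.ofHom (LinearMap.single R (fun _ ↦ S) j))).comp x _) 0, Ext.comp_zero]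

namespace IsShiftedDualClass

variable {c : ℕ} {α : Ext (ModuleCat.of R S) (ModuleCat.of R R) c}

lemma surjective_iff (hα : IsShiftedDualClass α) {K P : Type u} [AddCommGroup K]
    [Module R K] [Module S K] [IsScalarTower R S K] [AddCommGroup P] [Module R P] [Module S P]
    [IsScalarTower R S P]
    (f : K →ₗ[S] P) :
    (∀ x : Ext (ModuleCat.of R K) (ModuleCat.of R R) c,
      ∃ y : Ext (ModuleCat.of R P) (ModuleCat.of R R) c,
        (Ext.mk₀ (ModuleCat.ofHom (f.restrictScalars R))).comp y (zero_add c) = x) ↔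
    Function.Surjective (f.lcomp S S) := by
  have key (g : P →ₗ[S] S) : (Ext.mk₀ (ModuleCat.ofHom (f.restrictScalars R))).comp
      ((Ext.mk₀ (ModuleCat.ofHom (g.restrictScalars R))).comp α (zero_add c)) (zero_add c) =
      (Ext.mk₀ (ModuleCat.ofHom ((g ∘ₗ f).restrictScalars R))).comp α (zero_add c) := by
    rw [← Ext.comp_assoc_of_second_deg_zero, Ext.mk₀_comp_mk₀]
    rfl
  constructor
  · intro h x
    obtain ⟨y, hy⟩ := h ((Ext.mk₀ (ModuleCat.ofHom (x.restrictScalars R))).comp α (zero_add c))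
    obtain ⟨g, rfl⟩ := (hα.bijective P).2 y
    exact ⟨g, (hα.bijective K).1 ((key g).symm.trans hy)⟩
  · intro h x
    obtain ⟨x, rfl⟩ := (hα.bijective K).2 x
    obtain ⟨g, rfl⟩ := h x
    exact ⟨_, key g⟩

lemma subsingleton_ext_iff (hα : IsShiftedDualClass α) [IsNoetherianRing S] (N : Type u)
    [AddCommGroup N] [Module R N] [Module S N] [IsScalarTower R S N] [Module.Finite S N] (n : ℕ) :
    Subsingleton (Ext (ModuleCat.of R N) (ModuleCat.of R R) (c + n + 1)) ↔
      Subsingleton (Ext (ModuleCat.of S N) (ModuleCat.of S S) (n + 1)) := by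
  induction n generalizing N with
  | zero =>
    obtain ⟨m, f, hf⟩ := Module.Finite.exists_fin' S N
    have hS := LinearMap.shortExact_shortComplexKer hf
    have hS' := shortExact_of_linearMap (f := (LinearMap.ker f).subtype.restrictScalars R)
      (g := f.restrictScalars R) Subtype.val_injective f.exact_subtype_ker_map hf
    have := hα.subsingleton 0
    have h₁ := subsingleton_ext_X₃_iff_surjective hS
      (Ext.subsingleton_of_projective (ModuleCat.of S (Fin m → S)) (ModuleCat.of S S) 0)
    have h₂ := subsingleton_ext_X₃_iff_surjective hS'
      (subsingleton_ext_pi (S := S) (ι := Fin m) (ModuleCat.of R R) (c + 0 + 1))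
    refine h₂.trans (Iff.trans ?_ h₁.symm)
    rw [surjective_mk₀_comp_iff]
    exact hα.surjective_iff (LinearMap.ker f).subtype
  | succ n ih =>
    obtain ⟨m, f, hf⟩ := Module.Finite.exists_fin' S N
    have hS := LinearMap.shortExact_shortComplexKer hf
    have hS' := shortExact_of_linearMap (f := (LinearMap.ker f).subtype.restrictScalars R)
      (g := f.restrictScalars R) Subtype.val_injective f.exact_subtype_ker_map hf
    have := hα.subsingleton n
    have := hα.subsingleton (n + 1)
    have h₁ := subsingleton_ext_X₃_iff_X₁ hS
      (Ext.subsingleton_of_projective (ModuleCat.of S (Fin m → S)) (ModuleCat.of S S) n)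
      (Ext.subsingleton_of_projective (ModuleCat.of S (Fin m → S)) (ModuleCat.of S S) (n + 1))
    have h₂ := subsingleton_ext_X₃_iff_X₁ hS'
      (subsingleton_ext_pi (S := S) (ι := Fin m) (ModuleCat.of R R) (c + n + 1))
      (subsingleton_ext_pi (S := S) (ι := Fin m) (ModuleCat.of R R) (c + (n + 1) + 1))
    exact h₂.trans ((ih _).trans h₁.symm)

lemma hasInjectiveDimensionLT (hα : IsShiftedDualClass α) [IsNoetherianRing S] (n : ℕ)
    [HasInjectiveDimensionLT (ModuleCat.of R R) (c + n + 1)] :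
    HasInjectiveDimensionLT (ModuleCat.of S S) (n + 1) :=
  hasInjectiveDimensionLT_of_subsingleton_ext_quotient _ _ fun I ↦
    (hα.subsingleton_ext_iff (S ⧸ I) n).1
      (HasInjectiveDimensionLT.subsingleton _ (c + n + 1) _ le_rfl _)

lemma hasInjectiveDimensionLT_of_surjective (hα : IsShiftedDualClass α) [IsNoetherianRing S]
    [IsNoetherianRing R] [IsLocalRing R] [IsLocalRing S] (h : Function.Surjective (algebraMap R S))
    (n : ℕ)
    [HasInjectiveDimensionLT (ModuleCat.of S S) (n + 1)] :
    HasInjectiveDimensionLT (ModuleCat.of R R) (c + n + 1) := by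
  refine hasInjectiveDimensionLT_of_residue _ _ fun j hj ↦ ?_
  obtain ⟨i, rfl⟩ := Nat.exists_eq_add_of_le hj
  let k := S ⧸ IsLocalRing.maximalIdeal S
  have hsurj : Function.Surjective (algebraMap R k) := by
    rw [IsScalarTower.algebraMap_eq R S k]
    exact Ideal.Quotient.mk_surjective.comp h
  have hker : LinearMap.ker (Algebra.linearMap R k) = IsLocalRing.maximalIdeal R := by
    let := Ideal.Quotient.field (IsLocalRing.maximalIdeal S)
    exact IsLocalRing.eq_maximalIdeal (RingHom.ker_isMaximal_of_surjective (algebraMap R k) hsurj)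
  let e : ModuleCat.of R k ≅ ModuleCat.of R (R ⧸ IsLocalRing.maximalIdeal R) :=
    ((Submodule.quotEquivOfEq _ _ hker).symm ≪≫ₗ
      (Algebra.linearMap R k).quotKerEquivOfSurjective hsurj).symm.toModuleIso
  refine subsingleton_ext_of_iso_left e ?_
  rw [show c + n + 1 + i = c + (n + i) + 1 by lia]
  exact (hα.subsingleton_ext_iff k (n + i)).2
    (HasInjectiveDimensionLT.subsingleton _ (n + 1) _ (by lia) _)

end IsShiftedDualClass
end

section
open Module

variable {R S : Type u} [CommRing R] [CommRing S] [Algebra R S]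

lemma exists_isShiftedDualClass_zero (hsurj : Function.Surjective (algebraMap R S)) (s : R)
    (hs : ∀ r, r * s = 0 ↔ algebraMap R S r = 0)
    (hann : ∀ t, (∀ r, algebraMap R S r = 0 → r * t = 0) → ∃ u, u * s = t)
    (hext : ∀ i, Subsingleton (Ext (ModuleCat.of R S) (ModuleCat.of R R) (i + 1))) :
    ∃ α : Ext (ModuleCat.of R S) (ModuleCat.of R R) 0, IsShiftedDualClass α := by
  have hker : LinearMap.ker (Algebra.linearMap R S) =
      LinearMap.ker (LinearMap.toSpanSingleton R R s) := by
    ext r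
    simp [hs]
  let φ : S →ₗ[R] R := (LinearMap.ker (Algebra.linearMap R S)).liftQ
      (LinearMap.toSpanSingleton R R s) hker.le ∘ₗ
    ((Algebra.linearMap R S).quotKerEquivOfSurjective hsurj).symm.toLinearMap
  have hφ (r : R) : φ (algebraMap R S r) = r * s := by
    have : ((Algebra.linearMap R S).quotKerEquivOfSurjective hsurj).symm (algebraMap R S r) =
        Submodule.Quotient.mk r := by
      rw [LinearEquiv.symm_apply_eq]
      rfl
    rw [LinearMap.comp_apply, LinearEquiv.coe_coe, this]
    rfl
  have hinj : Function.Injective φ := by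
    rw [injective_iff_map_eq_zero]
    intro y hy
    obtain ⟨r, rfl⟩ := hsurj y
    rwa [hφ, hs] at hy
  refine ⟨Ext.mk₀ (ModuleCat.ofHom φ), fun L _ _ _ _ ↦ ⟨fun f g hfg ↦ ?_, fun x ↦ ?_⟩,
    fun i ↦ by rw [zero_add]; exact hext i⟩
  · simp only [Ext.mk₀_comp_mk₀] at hfg
    have := congrArg ModuleCat.Hom.hom ((Ext.mk₀_bijective _ _).1 hfg)
    exact LinearMap.ext fun l ↦ hinj (LinearMap.congr_fun this l)
  · obtain ⟨ψ, rfl⟩ := (Ext.mk₀_bijective _ _).2 x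
    have hψ (l : L) : ψ.hom l ∈ LinearMap.range φ := by
      obtain ⟨u, hu⟩ := hann (ψ.hom l) fun r hr ↦ by
        have h0 : r • l = 0 := by rw [← algebraMap_smul S r l, hr, zero_smul]
        rw [← smul_eq_mul, ← map_smul, h0, map_zero]
      exact ⟨algebraMap R S u, (hφ u).trans hu⟩
    let f : L →ₗ[R] S := (LinearEquiv.ofInjective φ hinj).symm.toLinearMap ∘ₗ
      ψ.hom.codRestrict (LinearMap.range φ) hψ
    refine ⟨f.extendScalarsOfSurjective hsurj, ?_⟩
    simp only [Ext.mk₀_comp_mk₀]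
    refine congrArg Ext.mk₀ (ModuleCat.hom_ext (LinearMap.ext fun l ↦ ?_))
    exact congrArg Subtype.val ((LinearEquiv.ofInjective φ hinj).apply_symm_apply
      (ψ.hom.codRestrict (LinearMap.range φ) hψ l))

lemma exists_isShiftedDualClass_one (hsurj : Function.Surjective (algebraMap R S)) (a : R)
    (hreg : IsSMulRegular R a) (hker : ∀ r, algebraMap R S r = 0 ↔ a ∣ r) :
    ∃ α : Ext (ModuleCat.of R S) (ModuleCat.of R R) 1, IsShiftedDualClass α := by
  have hS := shortExact_of_linearMap (f := LinearMap.lsmul R R a) (g := Algebra.linearMap R S)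
    hreg (fun r ↦ (hker r).trans ⟨fun ⟨c, hc⟩ ↦ ⟨c, hc.symm⟩, fun ⟨c, hc⟩ ↦ ⟨c, hc.symm⟩⟩) hsurj
  refine ⟨hS.extClass, fun L _ _ _ _ ↦ ?_, fun i ↦ ?_⟩
  · have ha (l : L) : a • l = 0 := by
      rw [← algebraMap_smul S a l, (hker a).2 dvd_rfl, zero_smul]
    have h0 : Subsingleton (Ext (ModuleCat.of R L) (ModuleCat.of R R) 0) := by
      refine subsingleton_of_forall_eq 0 fun x ↦ ?_
      obtain ⟨ψ, rfl⟩ := (Ext.mk₀_bijective _ _).2 x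
      rw [← Ext.mk₀_zero]
      refine congrArg Ext.mk₀ (ModuleCat.hom_ext (LinearMap.ext fun l ↦ hreg ?_))
      change a • ψ.hom l = a • 0
      rw [← map_smul, ha, map_zero, smul_zero]
    constructor
    · intro f g hfg
      have h : (Ext.mk₀ (ModuleCat.ofHom (f.restrictScalars R) -
          ModuleCat.ofHom (g.restrictScalars R))).comp hS.extClass (zero_add 1) = 0 := by
        rw [sub_eq_add_neg, Ext.mk₀_add, Ext.mk₀_neg, Ext.add_comp, Ext.neg_comp,
          ← sub_eq_add_neg, sub_eq_zero]
        exact hfg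
      obtain ⟨y, hy⟩ := Ext.covariant_sequence_exact₃ _ hS _ _ h
      rw [Subsingleton.elim y 0, Ext.zero_comp, ← Ext.mk₀_zero] at hy
      have := sub_eq_zero.1 ((Ext.mk₀_bijective _ _).1 hy).symm
      exact LinearMap.ext fun l ↦ LinearMap.congr_fun (congrArg ModuleCat.Hom.hom this) l
    · intro x
      have hx : x.comp (Ext.mk₀ (ModuleCat.ofHom (LinearMap.lsmul R R a))) (add_zero 1) = 0 := by
        have h₁ : ModuleCat.ofHom (LinearMap.lsmul R R a) = a • 𝟙 (ModuleCat.of R R) := rfl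
        have h₂ : a • 𝟙 (ModuleCat.of R L) = 0 :=
          ModuleCat.hom_ext (LinearMap.ext ha)
        rw [h₁, Ext.mk₀_smul, Ext.comp_smul, Ext.comp_mk₀_id, ← Ext.mk₀_id_comp x,
          ← Ext.smul_comp, ← Ext.mk₀_smul, h₂, Ext.mk₀_zero, Ext.zero_comp]
      obtain ⟨y, rfl⟩ := Ext.covariant_sequence_exact₁ _ hS x hx rfl
      obtain ⟨y, rfl⟩ := (Ext.mk₀_bijective _ _).2 y
      exact ⟨y.hom.extendScalarsOfSurjective hsurj, rfl⟩
  · rw [add_comm 1 i]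
    exact (subsingleton_ext_X₃_iff_X₁ hS
      (Ext.subsingleton_of_projective (ModuleCat.of R R) (ModuleCat.of R R) i)
      (Ext.subsingleton_of_projective (ModuleCat.of R R) (ModuleCat.of R R) (i + 1))).2
      (Ext.subsingleton_of_projective (ModuleCat.of R R) (ModuleCat.of R R) i)
end

section
open Module TensorProduct

lemma IsShiftedDualClass.exists_hasInjectiveDimensionLT_iff {R S : Type u} [CommRing R]
    [CommRing S] [Algebra R S] [IsNoetherianRing R] [IsNoetherianRing S] [IsLocalRing R]
    [IsLocalRing S] {c : ℕ} {α : Ext (ModuleCat.of R S) (ModuleCat.of R R) c}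
    (hα : IsShiftedDualClass α) (h : Function.Surjective (algebraMap R S)) :
    (∃ n, HasInjectiveDimensionLT (ModuleCat.of R R) n) ↔
      ∃ n, HasInjectiveDimensionLT (ModuleCat.of S S) n := by
  constructor
  · rintro ⟨n, hn⟩
    have := hasInjectiveDimensionLT_of_ge (ModuleCat.of R R) n (c + n + 1) (by lia)
    exact ⟨n + 1, hα.hasInjectiveDimensionLT n⟩
  · rintro ⟨n, hn⟩
    have := hasInjectiveDimensionLT_of_ge (ModuleCat.of S S) n (n + 1) (by lia)
    exact ⟨c + n + 1, hα.hasInjectiveDimensionLT_of_surjective h n⟩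

variable {A : Type u} [CommRing A]

lemma exists_mul_eq_zero_iff_mem_maximalIdeal [IsNoetherianRing A] [IsLocalRing A]
    (h : ∀ a ∈ IsLocalRing.maximalIdeal A, ¬ IsSMulRegular A a) :
    ∃ s : A, ∀ r, r * s = 0 ↔ r ∈ IsLocalRing.maximalIdeal A := by
  have h₁ : ¬ Subsingleton ((A ⧸ IsLocalRing.maximalIdeal A) →ₗ[A] A) := by
    rw [IsSMulRegular.subsingleton_linearMap_iff, Ideal.annihilator_quotient]
    simpa using h
  rw [not_subsingleton_iff_nontrivial] at h₁
  obtain ⟨f, hf⟩ := exists_ne (0 : (A ⧸ IsLocalRing.maximalIdeal A) →ₗ[A] A)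
  have key (r : A) : r * f (Submodule.Quotient.mk 1) = f (Submodule.Quotient.mk r) := by
    rw [← smul_eq_mul, ← map_smul, ← Submodule.Quotient.mk_smul, smul_eq_mul, mul_one]
  have hle : ∀ r ∈ IsLocalRing.maximalIdeal A, r * f (Submodule.Quotient.mk 1) = 0 := by
    intro r hr
    rw [key, (Submodule.Quotient.mk_eq_zero _).2 hr, map_zero]
  refine ⟨f (Submodule.Quotient.mk 1), fun r ↦ ⟨fun hr ↦ ?_, hle r⟩⟩
  rw [IsLocalRing.mem_maximalIdeal]
  intro hu
  refine hf (LinearMap.ext fun x ↦ ?_)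
  obtain ⟨x, rfl⟩ := Submodule.Quotient.mk_surjective _ x
  rw [← key, hu.mul_right_eq_zero.1 hr, mul_zero, LinearMap.zero_apply]

lemma exists_injective_of_mul_eq_zero_iff {I : Ideal A} {s : A} (hs : ∀ r, r * s = 0 ↔ r ∈ I) :
    ∃ f : (A ⧸ I) →ₗ[A] A, Function.Injective f ∧ ∀ r, f (Submodule.Quotient.mk r) = r * s := by
  refine ⟨Submodule.liftQ I (LinearMap.toSpanSingleton A A s) fun r hr ↦ (hs r).2 hr, ?_,
    fun r ↦ rfl⟩
  rw [injective_iff_map_eq_zero]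
  intro x hx
  obtain ⟨x, rfl⟩ := Submodule.Quotient.mk_surjective _ x
  exact (Submodule.Quotient.mk_eq_zero _).2 ((hs x).1 hx)

lemma hasInjectiveDimensionLT_pred [IsNoetherianRing A] [IsLocalRing A]
    (h : ∀ a ∈ IsLocalRing.maximalIdeal A, ¬ IsSMulRegular A a) (n : ℕ)
    [HasInjectiveDimensionLT (ModuleCat.of A A) (n + 2)] :
    HasInjectiveDimensionLT (ModuleCat.of A A) (n + 1) := by
  obtain ⟨s, hs⟩ := exists_mul_eq_zero_iff_mem_maximalIdeal h
  obtain ⟨f, hf, -⟩ := exists_injective_of_mul_eq_zero_iff hs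
  have hS := shortExact_of_linearMap hf f.exact_map_mkQ_range (Submodule.mkQ_surjective _)
  refine hasInjectiveDimensionLT_of_residue _ _ fun i hi ↦ ?_
  obtain ⟨i, rfl⟩ := Nat.exists_eq_add_of_le hi
  obtain _ | i := i
  · exact (subsingleton_ext_X₃_iff_X₁ hS
      (Ext.subsingleton_of_projective (ModuleCat.of A A) (ModuleCat.of A A) n)
      (Ext.subsingleton_of_projective (ModuleCat.of A A) (ModuleCat.of A A) (n + 1))).1
      (HasInjectiveDimensionLT.subsingleton _ (n + 2) _ le_rfl _)
  · exact HasInjectiveDimensionLT.subsingleton _ (n + 2) _ (by lia) _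

lemma isUnit_of_isSMulRegular [HasInjectiveDimensionLT (ModuleCat.of A A) 1] {a : A}
    (ha : IsSMulRegular A a) : IsUnit a := by
  have : Injective (ModuleCat.of A A) := injective_iff_hasInjectiveDimensionLT_one.2 ‹_›
  have : Mono (ModuleCat.ofHom (LinearMap.lsmul A A a)) :=
    (ModuleCat.mono_iff_injective _).2 ha
  have h := Injective.comp_factorThru (𝟙 (ModuleCat.of A A))
    (ModuleCat.ofHom (LinearMap.lsmul A A a))
  have h₁ := LinearMap.congr_fun (congrArg ModuleCat.Hom.hom h) (1 : A)
  set g := (Injective.factorThru (𝟙 (ModuleCat.of A A))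
    (ModuleCat.ofHom (LinearMap.lsmul A A a))).hom
  change g (a • (1 : A)) = 1 at h₁
  rw [map_smul] at h₁
  exact IsUnit.of_mul_eq_one _ h₁

lemma exists_mul_eq_of_injective [HasInjectiveDimensionLT (ModuleCat.of A A) 1] {I : Ideal A}
    {s : A} (hs : ∀ r, r * s = 0 ↔ r ∈ I) {t : A} (ht : ∀ r ∈ I, r * t = 0) :
    ∃ u, u * s = t := by
  have : Injective (ModuleCat.of A A) := injective_iff_hasInjectiveDimensionLT_one.2 ‹_›
  obtain ⟨f, hf, hf'⟩ := exists_injective_of_mul_eq_zero_iff hs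
  have : Mono (ModuleCat.ofHom f) := (ModuleCat.mono_iff_injective _).2 hf
  let ψ : (A ⧸ I) →ₗ[A] A := Submodule.liftQ I (LinearMap.toSpanSingleton A A t) ht
  have h := Injective.comp_factorThru (ModuleCat.ofHom ψ) (ModuleCat.ofHom f)
  have h₁ := LinearMap.congr_fun (congrArg ModuleCat.Hom.hom h) (Submodule.Quotient.mk 1)
  set g := (Injective.factorThru (ModuleCat.ofHom ψ) (ModuleCat.ofHom f)).hom
  change g (f (Submodule.Quotient.mk 1)) = (1 : A) * t at h₁
  rw [hf', one_mul, one_mul] at h₁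
  refine ⟨g (1 : A), ?_⟩
  rw [← h₁, mul_comm, ← smul_eq_mul]
  exact (map_smul g s (1 : A)).symm.trans (by rw [smul_eq_mul, mul_one])

variable {B : Type u} [CommRing B] [Algebra A B]

lemma map_finsupp_mem_map {k : ℕ} (y : (Fin k →₀ A) →ₗ[A] B) {v : Fin k →₀ A} {I : Ideal A}
    (hv : ∀ j, v j ∈ I) : y v ∈ I.map (algebraMap A B) := by
  rw [← Finsupp.sum_single v, Finsupp.sum, map_sum]
  refine sum_mem fun j _ ↦ ?_
  rw [← mul_one (v j), ← smul_eq_mul, ← Finsupp.smul_single, map_smul, Algebra.smul_def]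
  exact Ideal.mul_mem_right _ _ (Ideal.mem_map_of_mem _ (hv j))

lemma mul_algebraMap_eq_zero_iff [Flat A B] {I : Ideal A} {s : A}
    (hs : ∀ r, r * s = 0 ↔ r ∈ I) (b : B) :
    b * algebraMap A B s = 0 ↔ b ∈ I.map (algebraMap A B) := by
  constructor
  · intro hb
    obtain ⟨k, a, y, hy, ha⟩ := Flat.exists_factorization_of_apply_eq_zero_of_free (R := A)
      (f := s) (x := LinearMap.toSpanSingleton A B b)
      (by rw [LinearMap.toSpanSingleton_apply, Algebra.smul_def, mul_comm, hb])
    have hb : b = y (a 1) := by simpa using LinearMap.congr_fun hy 1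
    rw [hb]
    refine map_finsupp_mem_map y fun j ↦ (hs _).1 ?_
    rw [mul_comm, ← smul_eq_mul, ← Finsupp.smul_apply, ← map_smul, smul_eq_mul, mul_one, ha,
      Finsupp.zero_apply]
  · intro hb
    induction hb using Submodule.span_induction with
    | mem x hx =>
      obtain ⟨r, hr, rfl⟩ := hx
      rw [← map_mul, (hs r).2 hr, map_zero]
    | zero => rw [zero_mul]
    | add x y _ _ hx hy => rw [add_mul, hx, hy, add_zero]
    | smul c x _ hx => rw [smul_eq_mul, mul_assoc, hx, mul_zero]

lemma exists_mul_algebraMap_eq [IsNoetherianRing A] [Flat A B] {I : Ideal A} {s : A}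
    (hs : ∀ t, (∀ r ∈ I, r * t = 0) → ∃ u, u * s = t) {t : B}
    (ht : ∀ r ∈ I, algebraMap A B r * t = 0) : ∃ u, u * algebraMap A B s = t := by
  have := finitePresentation_of_finite A (A ⧸ I)
  let ψ : (A ⧸ I) →ₗ[A] B := Submodule.liftQ I (LinearMap.toSpanSingleton A B t) fun r hr ↦ by
    rw [LinearMap.mem_ker, LinearMap.toSpanSingleton_apply, Algebra.smul_def, ht r hr]
  obtain ⟨k, a, y, hy⟩ := Flat.exists_factorization_of_finitePresentation ψ
  have h := LinearMap.congr_fun hy (Submodule.Quotient.mk 1)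
  have hψ : ψ (Submodule.Quotient.mk 1) = t := one_smul A t
  rw [hψ] at h
  have hmem : t ∈ (Ideal.span {s}).map (algebraMap A B) := by
    rw [h]
    refine map_finsupp_mem_map y fun j ↦ ?_
    rw [Ideal.mem_span_singleton']
    refine hs _ fun r hr ↦ ?_
    rw [← smul_eq_mul, ← Finsupp.smul_apply, ← map_smul, ← Submodule.Quotient.mk_smul,
      smul_eq_mul, mul_one, (Submodule.Quotient.mk_eq_zero _).2 hr, map_zero, Finsupp.zero_apply]
  rwa [Ideal.map_span, Set.image_singleton, Ideal.mem_span_singleton'] at hmem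
end

section
open Module TensorProduct IsLocalRing

lemma exists_isShiftedDualClass_closedFiber {A B F : Type u} [CommRing A] [CommRing B]
    [CommRing F] [IsNoetherianRing A] [IsLocalRing A] [Algebra A B] [Algebra B F]
    [FaithfullyFlat A B] (hsurj : Function.Surjective (algebraMap B F))
    (hker : ∀ b, algebraMap B F b = 0 ↔ b ∈ (maximalIdeal A).map (algebraMap A B))
    [HasInjectiveDimensionLT (ModuleCat.of A A) 1] :
    ∃ α : Ext (ModuleCat.of B F) (ModuleCat.of B B) 0, IsShiftedDualClass α := by
  obtain ⟨s, hs⟩ := exists_mul_eq_zero_iff_mem_maximalIdeal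
    fun (a : A) ha h ↦ (mem_maximalIdeal a).1 ha (isUnit_of_isSMulRegular h)
  refine exists_isShiftedDualClass_zero hsurj (algebraMap A B s)
    (fun b ↦ (mul_algebraMap_eq_zero_iff hs b).trans (hker b).symm) (fun t ht ↦ ?_) fun i ↦ ?_
  · exact exists_mul_algebraMap_eq (fun t ht ↦ exists_mul_eq_of_injective hs ht)
      fun r hr ↦ ht _ ((hker _).2 (Ideal.mem_map_of_mem _ hr))
  · have : LinearMap.ker (Algebra.linearMap B F) = (maximalIdeal A).map (algebraMap A B) :=
      Submodule.ext hker
    have e : B ⊗[A] (A ⧸ maximalIdeal A) ≃ₗ[B] F :=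
      (Algebra.TensorProduct.quotIdealMapEquivTensorQuot B (maximalIdeal A)).symm.toLinearEquiv ≪≫ₗ
        Submodule.quotEquivOfEq _ _ this.symm ≪≫ₗ
        (Algebra.linearMap B F).quotKerEquivOfSurjective hsurj
    exact subsingleton_ext_of_iso_left e.toModuleIso
      ((subsingleton_ext_baseChange_self_iff B (A ⧸ maximalIdeal A) i).2
        (HasInjectiveDimensionLT.subsingleton _ 1 _ (by lia) _))

lemma Ideal.Quotient.mk_span_singleton_eq_zero_iff {R : Type u} [CommRing R] (a r : R) :
    algebraMap R (R ⧸ Ideal.span {a}) r = 0 ↔ a ∣ r := by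
  rw [Ideal.Quotient.algebraMap_eq, Ideal.Quotient.eq_zero_iff_mem, Ideal.mem_span_singleton]

theorem exists_hasInjectiveDimensionLT_iff_closedFiber (n : ℕ) : ∀ (A B F : Type u) [CommRing A]
    [CommRing B] [CommRing F] [IsNoetherianRing A] [IsNoetherianRing B] [IsNoetherianRing F]
    [IsLocalRing A] [IsLocalRing B] [IsLocalRing F] [Algebra A B] [Algebra B F]
    [FaithfullyFlat A B] (_ : Function.Surjective (algebraMap B F))
    (_ : ∀ b, algebraMap B F b = 0 ↔ b ∈ (maximalIdeal A).map (algebraMap A B))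
    [HasInjectiveDimensionLT (ModuleCat.of A A) (n + 1)],
    (∃ k, HasInjectiveDimensionLT (ModuleCat.of B B) k) ↔
      ∃ k, HasInjectiveDimensionLT (ModuleCat.of F F) k := by
  induction n with
  | zero =>
    intro A B F _ _ _ _ _ _ _ _ _ _ _ _ hsurj hker _
    obtain ⟨α, hα⟩ := exists_isShiftedDualClass_closedFiber hsurj hker
    exact hα.exists_hasInjectiveDimensionLT_iff hsurj
  | succ n ih =>
    intro A B F _ _ _ _ _ _ _ _ _ _ _ _ hsurj hker _
    by_cases h : ∀ a ∈ maximalIdeal A, ¬ IsSMulRegular A a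
    · have := hasInjectiveDimensionLT_pred h n
      exact ih A B F hsurj hker
    push Not at h
    obtain ⟨a, ha, hreg⟩ := h
    let I := Ideal.span {a}
    let J := I.map (algebraMap A B)
    have hJ : J = Ideal.span {algebraMap A B a} := by
      rw [show J = I.map (algebraMap A B) from rfl, Ideal.map_span, Set.image_singleton]
    have hIm : I ≤ maximalIdeal A := (Ideal.span_singleton_le_iff_mem _).2 ha
    have hJF : ∀ b ∈ J, algebraMap B F b = 0 := fun b hb ↦
      (hker b).2 (Ideal.map_mono hIm hb)
    let _ : Algebra (B ⧸ J) F := (Ideal.Quotient.lift J (algebraMap B F) hJF).toAlgebra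
    have hmk (b : B) : algebraMap (B ⧸ J) F (Ideal.Quotient.mk J b) = algebraMap B F b := rfl
    have : Nontrivial (B ⧸ J) := (algebraMap (B ⧸ J) F).domain_nontrivial
    have : Nontrivial (A ⧸ I) := (algebraMap (A ⧸ I) (B ⧸ J)).domain_nontrivial
    have hA := Ideal.Quotient.mk_surjective (I := I)
    have hB := Ideal.Quotient.mk_surjective (I := J)
    have : IsLocalRing (A ⧸ I) := .of_surjective' _ hA
    have : IsLocalRing (B ⧸ J) := .of_surjective' _ hB
    have : FaithfullyFlat (A ⧸ I) (B ⧸ J) := .of_linearEquiv _ _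
      (Algebra.TensorProduct.quotIdealMapEquivQuotTensor B I).toLinearEquiv
    obtain ⟨α, hα⟩ := exists_isShiftedDualClass_one (S := A ⧸ I) hA a hreg
      (Ideal.Quotient.mk_span_singleton_eq_zero_iff a)
    obtain ⟨β, hβ⟩ := exists_isShiftedDualClass_one (S := B ⧸ J) hB (algebraMap A B a)
      (hreg.of_flat) fun b ↦ by
        rw [Ideal.Quotient.algebraMap_eq, Ideal.Quotient.eq_zero_iff_mem, hJ,
          Ideal.mem_span_singleton]
    have : HasInjectiveDimensionLT (ModuleCat.of A A) (1 + n + 1) := by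
      rwa [Nat.add_comm 1 n]
    have := hα.hasInjectiveDimensionLT n
    have hmax : maximalIdeal (A ⧸ I) = (maximalIdeal A).map (Ideal.Quotient.mk I) := by
      refine le_antisymm (fun x hx ↦ ?_) ?_
      · obtain ⟨x, rfl⟩ := hA x
        refine Ideal.mem_map_of_mem _ ?_
        rw [mem_maximalIdeal] at hx ⊢
        exact fun hu ↦ hx (hu.map _)
      · rw [Ideal.map_le_iff_le_comap]
        exact ((local_hom_TFAE (Ideal.Quotient.mk I)).out 0 3).1 (IsLocalHom.of_surjective _ hA)
    refine (hβ.exists_hasInjectiveDimensionLT_iff hB).trans (ih (A ⧸ I) (B ⧸ J) F ?_ fun b ↦ ?_)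
    · exact fun y ↦ (hsurj y).imp' (Ideal.Quotient.mk J) fun b hb ↦ hb
    · obtain ⟨b, rfl⟩ := hB b
      have hcomp : (algebraMap (A ⧸ I) (B ⧸ J)).comp (Ideal.Quotient.mk I) =
          (Ideal.Quotient.mk J).comp (algebraMap A B) := rfl
      rw [hmk, hker, hmax, Ideal.map_map, hcomp, ← Ideal.map_map,
        Ideal.mem_quotient_iff_mem (Ideal.map_mono hIm)]
end

lemma isGorensteinLocalRing_iff (R : Type) [CommRing R] [IsNoetherianRing R] [IsLocalRing R] :
    IsGorensteinLocalRing R ↔ ∃ n, HasInjectiveDimensionLT (ModuleCat.of R R) n := by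
  rw [IsGorensteinLocalRing, exists_subsingleton_derived_ext_iff]
  exact ⟨fun h ↦ h.2.2, fun h ↦ ⟨‹_›, ‹_›, h⟩⟩

end

/-- If `A → B` is a flat local homomorphism of Noetherian local rings, then
`B` is Gorenstein iff both `A` and `B/𝔪_A B` are Gorenstein. -/
theorem stmt19 (A B : Type) [CommRing A] [CommRing B]
    [IsNoetherianRing A] [IsNoetherianRing B]
    [IsLocalRing A] [IsLocalRing B]
    (f : A →+* B) (hloc : IsLocalHom f)
    (hflat : letI := f.toAlgebra; Module.Flat A B) :
    IsGorensteinLocalRing B ↔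
      IsGorensteinLocalRing A ∧
        IsGorensteinLocalRing (B ⧸ Ideal.map f (IsLocalRing.maximalIdeal A)) := by
  let _ := f.toAlgebra
  have : IsLocalHom (algebraMap A B) := hloc
  have : Module.FaithfullyFlat A B := Module.FaithfullyFlat.of_flat_of_isLocalHom
  set F := B ⧸ Ideal.map f (IsLocalRing.maximalIdeal A)
  have hsurj : Function.Surjective (algebraMap B F) := Ideal.Quotient.mk_surjective
  have : Nontrivial F := Ideal.Quotient.nontrivial_iff.2 fun h ↦
    IsLocalRing.maximalIdeal.isMaximal B |>.ne_top <| top_le_iff.1 <|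
      h.ge.trans (((IsLocalRing.local_hom_TFAE f).out 0 2).1 hloc)
  have : IsLocalRing F := .of_surjective' _ hsurj
  have key (n : ℕ) (h : HasInjectiveDimensionLT (ModuleCat.of A A) (n + 1)) :=
    exists_hasInjectiveDimensionLT_iff_closedFiber n A B F hsurj
      fun b ↦ Ideal.Quotient.eq_zero_iff_mem
  rw [isGorensteinLocalRing_iff, isGorensteinLocalRing_iff A, isGorensteinLocalRing_iff F]
  constructor
  · rintro ⟨n, hn⟩
    have := hasInjectiveDimensionLT_of_ge (ModuleCat.of B B) n (n + 1) (by lia)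
    have h := hasInjectiveDimensionLT_of_faithfullyFlat (A := A) B n
    exact ⟨⟨n + 1, h⟩, (key n h).1 ⟨n, hn⟩⟩
  · rintro ⟨⟨n, hn⟩, h⟩
    exact (key n (hasInjectiveDimensionLT_of_ge (ModuleCat.of A A) n (n + 1) (by lia))).2 h
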